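/- For every integer n ≥ 2 and every integer q ≥ 2, the minimum of the input entropy H^In_{1-Del}(y) over all channel outputs y ∈ Σ_q^{n−1} equals log₂(nq) − log₂(n)/q, and it is attained exactly by the q constant words of Σ_q^{n−1} (the words with a single run). -/

import Mathlib

open scoped Classical

noncomputable section

/-- The embedding number `ω_y(x)`: the number of distinct occurrences of `y`
as a subsequence of `x` (i.e. the number of index tuples realizing `y` in `x`). -/
def emb {q : ℕ} (y x : List (Fin q)) : ℕ := x.sublists.count y

/-- The run length profile of a word: the list of lengths of its maximal
blocks of identical consecutive symbols, in order. -/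
def runLengths {α : Type*} [DecidableEq α] : List α → List ℕ
  | [] => []
  | [_] => [1]
  | a :: b :: l =>
    if a = b then
      match runLengths (b :: l) with
      | [] => [1]
      | r :: rs => (r + 1) :: rs
    else 1 :: runLengths (b :: l)

/-- Input entropy `H^In_{k-Del}(y)` of the `k`-deletion channel over `Σ_q`
under uniform transmission, for a channel output `y ∈ Σ_q^{n-k}`:
`-∑_{x ∈ I_k(y)} p(x) log₂ p(x)` with `p(x) = ω_y(x) / (C(n,k) q^k)`. -/
def Hdel (q n k : ℕ) (y : Fin (n - k) → Fin q) : ℝ :=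
  - ∑ x ∈ Finset.univ.filter
      (fun x : Fin n → Fin q => (List.ofFn y).Sublist (List.ofFn x)),
      ((emb (List.ofFn y) (List.ofFn x) : ℝ) / ((n.choose k : ℝ) * (q : ℝ) ^ k)) *
        Real.logb 2 ((emb (List.ofFn y) (List.ofFn x) : ℝ) / ((n.choose k : ℝ) * (q : ℝ) ^ k))

/-- Input entropy `H^In_{k-Ins}(y)` of the `k`-insertion channel over `Σ_q`
under uniform transmission, for a channel output `y ∈ Σ_q^{n+k}`:
`-∑_{x ∈ D_k(y)} p(x) log₂ p(x)` with `p(x) = ω_x(y) / C(n+k,k)`. -/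
def Hins (q n k : ℕ) (y : Fin (n + k) → Fin q) : ℝ :=
  - ∑ x ∈ Finset.univ.filter
      (fun x : Fin n → Fin q => (List.ofFn x).Sublist (List.ofFn y)),
      ((emb (List.ofFn x) (List.ofFn y) : ℝ) / ((n + k).choose k : ℝ)) *
        Real.logb 2 ((emb (List.ofFn x) (List.ofFn y) : ℝ) / ((n + k).choose k : ℝ))

/-- A run length profile `rl` of a word of length `m` with `R` runs is balanced if it
consists of `m mod R` runs of length `⌈m/R⌉` and `R - (m mod R)` runs of length `⌊m/R⌋`. -/
def isBalanced (m R : ℕ) (rl : List ℕ) : Prop :=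
  rl.Perm (List.replicate (m % R) ((m + R - 1) / R) ++ List.replicate (R - m % R) (m / R))

/-- A run length profile `rl` of a word of length `m` with `R` runs is skewed if it
consists of `R - 1` runs of length `1` and a single run of length `m - (R-1)`. -/
def isSkewed (m R : ℕ) (rl : List ℕ) : Prop :=
  rl.Perm ((m - (R - 1)) :: List.replicate (R - 1) 1)

/-- `fIdx rl i` is the smallest (1-based) index `j ∈ [i+1, R]` with `r_j > 1`;
it is `R` if no such index exists, and `fIdx rl R = R`. -/
def fIdx (rl : List ℕ) (i : ℕ) : ℕ :=
  if i = rl.length then rl.length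
  else if {j | i + 1 ≤ j ∧ j ≤ rl.length ∧ 1 < rl.getD (j - 1) 0}.Nonempty
    then sInf {j | i + 1 ≤ j ∧ j ≤ rl.length ∧ 1 < rl.getD (j - 1) 0}
    else rl.length

/-- `bIdx rl i` is the largest (1-based) index `j ∈ [1, i]` with `r_j > 1`;
it is `1` if no such index exists, and `bIdx rl 0 = 1`. -/
def bIdx (rl : List ℕ) (i : ℕ) : ℕ :=
  if i = 0 then 1
  else if {j | 1 ≤ j ∧ j ≤ i ∧ 1 < rl.getD (j - 1) 0}.Nonempty
    then sSup {j | 1 ≤ j ∧ j ≤ i ∧ 1 < rl.getD (j - 1) 0}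
    else 1

/-- A sum over words of length `n + 1`, split
according to their first letter. -/
lemma sum_word_succ {q n : ℕ} {M : Type*} [AddCommMonoid M] (g : List (Fin q) → M) :
    ∑ x : Fin (n + 1) → Fin q, g (List.ofFn x)
      = ∑ a : Fin q, ∑ x : Fin n → Fin q, g (a :: List.ofFn x) := by
  rw [← (Fin.consEquiv (fun _ => Fin q)).sum_comp, Fintype.sum_prod_type]
  simp [Fin.consEquiv, List.ofFn_succ]

lemma emb_nil_left {q : ℕ} (x : List (Fin q)) : emb [] x = 1 := by
  unfold emb
  rw [(List.sublists_perm_sublists' x).count_eq]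
  induction x with
  | nil => simp
  | cons a x ih =>
    rw [List.sublists'_cons, List.count_append, ih, List.count_eq_zero_of_not_mem]
    simp

lemma emb_cons_nil {q : ℕ} (b : Fin q) (y : List (Fin q)) : emb (b :: y) [] = 0 := by
  simp [emb]

lemma emb_cons_cons {q : ℕ} (a b : Fin q) (y x : List (Fin q)) :
    emb (b :: y) (a :: x) = emb (b :: y) x + if a = b then emb y x else 0 := by
  unfold emb
  simp only [(List.sublists_perm_sublists' _).count_eq]
  rw [List.sublists'_cons, List.count_append]
  congr 1
  split_ifs with h
  · subst h
    exact List.count_map_of_injective _ _ (List.cons_injective) _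
  · apply List.count_eq_zero_of_not_mem
    simp [h]

lemma emb_pos_iff {q : ℕ} (y x : List (Fin q)) : 0 < emb y x ↔ y.Sublist x := by
  rw [emb, List.count_pos_iff, List.mem_sublists]

lemma emb_eq_zero_of_not_sublist {q : ℕ} {y x : List (Fin q)} (h : ¬ y.Sublist x) :
    emb y x = 0 :=
  Nat.eq_zero_of_not_pos fun hp => h ((emb_pos_iff y x).1 hp)

lemma emb_eq_ite_of_length_eq {q : ℕ} (y x : List (Fin q)) (h : x.length = y.length) :
    emb y x = if x = y then 1 else 0 := by
  induction y generalizing x with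
  | nil => simp_all [emb_nil_left]
  | cons b y ih =>
    cases x with
    | nil => simp at h
    | cons a x =>
      have h' : x.length = y.length := by simpa using h
      have h0 : emb (b :: y) x = 0 := emb_eq_zero_of_not_sublist fun hs => by
        have := hs.length_le
        simp at this
        omega
      rw [emb_cons_cons, h0, ih x h']
      by_cases hab : a = b <;> simp [hab]

lemma sum_ite_ofFn_eq {q : ℕ} {m : ℕ} (y : List (Fin q)) (h : y.length = m) :
    ∑ x : Fin m → Fin q, (if List.ofFn x = y then (1 : ℕ) else 0) = 1 := by
  subst h
  rw [Finset.sum_eq_single y.get]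
  · simp
  · intro x _ hx
    rw [if_neg]
    intro h'
    apply hx
    apply List.ofFn_injective
    simpa using h'
  · simp

/-- Every word `y` has `q * (|y| + 1)` single-letter insertions, counted with multiplicity. -/
lemma sum_emb {q : ℕ} (y : List (Fin q)) {m : ℕ} (h : y.length = m) :
    ∑ x : Fin (m + 1) → Fin q, emb y (List.ofFn x) = q * (m + 1) := by
  induction y generalizing m with
  | nil =>
    subst h
    simp [emb_nil_left]
  | cons b y ih =>
    cases m with
    | zero => simp at h
    | succ m =>
      have h1 : ∑ x : Fin (m + 1) → Fin q, emb (b :: y) (List.ofFn x) = 1 := by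
        refine (Finset.sum_congr rfl fun x _ => ?_).trans (sum_ite_ofFn_eq (b :: y) h)
        rw [emb_eq_ite_of_length_eq _ _ (by rw [h, List.length_ofFn])]
      rw [sum_word_succ (emb (b :: y))]
      simp only [emb_cons_cons, Finset.sum_add_distrib, h1]
      rw [Finset.sum_comm]
      simp only [Finset.sum_const, Finset.card_univ, Fintype.card_fin, smul_eq_mul, mul_one,
        Finset.sum_ite_eq', Finset.mem_univ, if_true, ih (m := m) (by simpa using h)]
      ring

/-- The single-insertion ball of a word of length `m` has `1 + (m + 1) (q - 1)` elements. -/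
lemma card_insertion_ball {q : ℕ} (y : List (Fin q)) {m : ℕ} (h : y.length = m) :
    (∑ x : Fin (m + 1) → Fin q, if y.Sublist (List.ofFn x) then (1 : ℕ) else 0) + m
      = q * (m + 1) := by
  induction y generalizing m with
  | nil =>
    subst h
    simp
  | cons b y ih =>
    cases m with
    | zero => simp at h
    | succ m =>
      have h1 : ∑ x : Fin (m + 1) → Fin q,
          (if (b :: y).Sublist (List.ofFn x) then (1 : ℕ) else 0) = 1 := by
        refine (Finset.sum_congr rfl fun x _ => ?_).trans (sum_ite_ofFn_eq (b :: y) h)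
        congr 1
        refine propext ⟨fun hs => (hs.eq_of_length (by rw [h]; simp)).symm, fun hs => ?_⟩
        rw [hs]
      rw [sum_word_succ (fun x => if (b :: y).Sublist x then (1 : ℕ) else 0),
        ← Finset.add_sum_erase _ _ (Finset.mem_univ b)]
      have h2 : ∀ a ∈ Finset.univ.erase b, ∑ x : Fin (m + 1) → Fin q,
          (if (b :: y).Sublist (a :: List.ofFn x) then (1 : ℕ) else 0) = 1 := by
        intro a ha
        refine (Finset.sum_congr rfl fun x _ => ?_).trans h1
        congr 1
        refine propext ⟨fun hs => ?_, fun hs => hs.cons a⟩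
        cases hs with
        | cons _ hs => exact hs
        | cons_cons _ hs => simp at ha
      rw [Finset.sum_congr rfl h2]
      have h3 := ih (m := m) (by simpa using h)
      have hq : 0 < q := b.pos
      simp only [List.cons_sublist_cons, Finset.sum_const, Finset.card_erase_of_mem,
        Finset.mem_univ, Finset.card_univ, Fintype.card_fin, smul_eq_mul, mul_one]
      have : q * (m + 1 + 1) = q * (m + 1) + q := by ring
      omega

lemma emb_le {q : ℕ} (y x : List (Fin q)) (h : x.length = y.length + 1) :
    emb y x ≤ y.length + 1 := by
  induction y generalizing x with
  | nil => simp [emb_nil_left]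
  | cons b y ih =>
    cases x with
    | nil => simp at h
    | cons a x =>
      have h' : x.length = (b :: y).length := by simpa using h
      have h1 := ih x (by simpa using h')
      rw [emb_cons_cons, emb_eq_ite_of_length_eq _ _ h', List.length_cons]
      split_ifs <;> omega

lemma eq_replicate_of_emb_eq {q : ℕ} (y x : List (Fin q)) (h : x.length = y.length + 1)
    (he : emb y x = y.length + 1) :
    ∃ a, x = List.replicate (y.length + 1) a ∧ y = List.replicate y.length a := by
  induction y generalizing x with
  | nil =>
    obtain ⟨a, rfl⟩ := List.length_eq_one_iff.1 (by simpa using h)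
    exact ⟨a, by simp⟩
  | cons b y ih =>
    cases x with
    | nil => simp at h
    | cons a x =>
      have h' : x.length = (b :: y).length := by simpa using h
      have h1 := emb_le y x (by simpa using h')
      rw [emb_cons_cons, emb_eq_ite_of_length_eq _ _ h', List.length_cons] at he
      split_ifs at he with hx hab hab
      · obtain ⟨c, hc, hy⟩ := ih x (by simpa using h') (by omega)
        have hbc : b = c := by
          rw [hx, List.replicate_succ] at hc
          exact (List.cons.inj hc).1
        subst hbc hab
        refine ⟨a, ?_, ?_⟩
        · rw [hc]; simp [List.replicate_succ]
        · rw [List.length_cons, List.replicate_succ, ← hy]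
      all_goals omega

lemma emb_replicate {q : ℕ} (a : Fin q) (m : ℕ) :
    emb (List.replicate m a) (List.replicate (m + 1) a) = m + 1 := by
  induction m with
  | zero => simp [emb_nil_left]
  | succ m ih =>
    rw [List.replicate_succ, List.replicate_succ (n := m + 1), emb_cons_cons,
      ← List.replicate_succ, emb_eq_ite_of_length_eq _ _ (by simp)]
    simp [ih]
    omega

lemma runLengths_cons_ne_nil {α : Type*} [DecidableEq α] (a : α) (l : List α) :
    runLengths (a :: l) ≠ [] := by
  cases l with
  | nil => simp [runLengths]
  | cons b l =>
    rw [runLengths]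
    split_ifs
    · split <;> simp
    · simp

lemma length_runLengths_cons_eq_one_iff {α : Type*} [DecidableEq α] (a : α) (l : List α) :
    (runLengths (a :: l)).length = 1 ↔ l = List.replicate l.length a := by
  induction l generalizing a with
  | nil => simp [runLengths]
  | cons b l ih =>
    have hne := runLengths_cons_ne_nil b l
    have hb := ih b
    rw [runLengths]
    split_ifs with hab
    · subst hab
      rw [List.length_cons, List.replicate_succ, List.cons.injEq, ← hb]
      split
      · contradiction
      · rename_i h; simp [h]
    · simp [hne, List.replicate_succ, Ne.symm hab]

lemma length_runLengths_eq_one_iff {α : Type*} [DecidableEq α] {y : List α} (hy : y ≠ []) :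
    (runLengths y).length = 1 ↔ ∃ a, y = List.replicate y.length a := by
  obtain ⟨b, l, rfl⟩ := List.exists_cons_of_ne_nil hy
  rw [length_runLengths_cons_eq_one_iff]
  simp only [List.length_cons, List.replicate_succ, List.cons.injEq]
  exact ⟨fun h => ⟨b, rfl, h⟩, by rintro ⟨a, rfl, h⟩; exact h⟩

/-- The chord of `x * log x` over `[1, m + 1]` lies strictly above the graph inside. -/
lemma mul_mul_log_lt {m k : ℝ} (hk : 1 < k) (hkm : k < m + 1) :
    m * (k * Real.log k) < (k - 1) * ((m + 1) * Real.log (m + 1)) := by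
  have hm : 0 < m := by linarith
  have h1 : (1 : ℝ) ∈ Set.Ici 0 := Set.mem_Ici.2 zero_le_one
  have h2 : m + 1 ∈ Set.Ici (0 : ℝ) := Set.mem_Ici.2 (by positivity)
  have h3 : (m + 1 - k) / m + (k - 1) / m = 1 := by field_simp; ring
  have h := Real.strictConvexOn_mul_log.2 h1 h2 (by linarith)
    (div_pos (by linarith) hm) (div_pos (by linarith) hm) h3
  have hc : (m + 1 - k) / m * 1 + (k - 1) / m * (m + 1) = k := by field_simp; ring
  simp only [smul_eq_mul, hc, Real.log_one, mul_zero, zero_add] at h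
  calc m * (k * Real.log k) < m * ((k - 1) / m * ((m + 1) * Real.log (m + 1))) :=
        mul_lt_mul_of_pos_left h hm
    _ = _ := by field_simp

lemma mul_mul_log_le {m k : ℝ} (hk : 1 ≤ k) (hkm : k ≤ m + 1) :
    m * (k * Real.log k) ≤ (k - 1) * ((m + 1) * Real.log (m + 1)) := by
  rcases hk.eq_or_lt with rfl | hk
  · simp
  rcases hkm.eq_or_lt with rfl | hkm
  · simp
  · exact (mul_mul_log_lt hk hkm).le

/-- The excess multiplicities `ω_y(x) - 1` over the single-insertion ball sum to `|y|`. -/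
lemma sum_emb_sub_one {q m : ℕ} (y : List (Fin q)) (h : y.length = m) :
    ∑ x : Fin (m + 1) → Fin q with y.Sublist (List.ofFn x),
      ((emb y (List.ofFn x) : ℝ) - 1) = m := by
  have h1 := sum_emb y h
  have h2 := card_insertion_ball y h
  rw [← Finset.sum_filter] at h2
  rw [← Finset.sum_filter_of_ne (p := fun x => y.Sublist (List.ofFn x))
    (fun x _ hx => (emb_pos_iff _ _).1 (Nat.pos_of_ne_zero hx)), ← h2] at h1
  rw [Finset.sum_sub_distrib]
  have h1' := congrArg (Nat.cast (R := ℝ)) h1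
  push_cast at h1'
  linarith

lemma emb_bounds {q m : ℕ} {y : List (Fin q)} (h : y.length = m) {x : Fin (m + 1) → Fin q}
    (hx : y.Sublist (List.ofFn x)) :
    (1 : ℝ) ≤ emb y (List.ofFn x) ∧ (emb y (List.ofFn x) : ℝ) ≤ m + 1 := by
  subst h
  exact ⟨by exact_mod_cast (emb_pos_iff _ _).2 hx, by exact_mod_cast emb_le y _ (by simp)⟩

lemma sum_emb_mul_log_le {q m : ℕ} (hm : 0 < m) (y : List (Fin q)) (h : y.length = m) :
    ∑ x : Fin (m + 1) → Fin q with y.Sublist (List.ofFn x),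
      (emb y (List.ofFn x) : ℝ) * Real.log (emb y (List.ofFn x))
        ≤ (m + 1) * Real.log (m + 1) := by
  have hm' : (0 : ℝ) < m := by exact_mod_cast hm
  refine le_of_mul_le_mul_left ?_ hm'
  conv_rhs => rw [← congrArg (· * _) (sum_emb_sub_one y h), Finset.sum_mul]
  rw [Finset.mul_sum]
  refine Finset.sum_le_sum fun x hx => ?_
  obtain ⟨h1, h2⟩ := emb_bounds h (Finset.mem_filter.1 hx).2
  exact mul_mul_log_le h1 h2

lemma sum_emb_mul_log_lt {q m : ℕ} (hm : 0 < m) (y : List (Fin q)) (h : y.length = m)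
    (hy : ¬ ∃ a, y = List.replicate y.length a) :
    ∑ x : Fin (m + 1) → Fin q with y.Sublist (List.ofFn x),
      (emb y (List.ofFn x) : ℝ) * Real.log (emb y (List.ofFn x))
        < (m + 1) * Real.log (m + 1) := by
  have hm' : (0 : ℝ) < m := by exact_mod_cast hm
  have hs := sum_emb_sub_one y h
  obtain ⟨x₀, hx₀, hpos⟩ := Finset.exists_lt_of_sum_lt (f := fun _ => (0 : ℝ))
    (by rwa [← hs, ← Finset.sum_const_zero] at hm')
  refine lt_of_mul_lt_mul_left ?_ hm'.le
  conv_rhs => rw [← congrArg (· * _) hs, Finset.sum_mul]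
  rw [Finset.mul_sum]
  refine Finset.sum_lt_sum (fun x hx => ?_) ⟨x₀, hx₀, ?_⟩
  · obtain ⟨h1, h2⟩ := emb_bounds h (Finset.mem_filter.1 hx).2
    exact mul_mul_log_le h1 h2
  · obtain ⟨-, h2⟩ := emb_bounds h (Finset.mem_filter.1 hx₀).2
    refine mul_mul_log_lt (by linarith) (h2.lt_of_ne fun he => hy ?_)
    obtain ⟨a, -, ha⟩ := eq_replicate_of_emb_eq y (List.ofFn x₀) (by simp [h])
      (by rw [h]; exact_mod_cast he)
    exact ⟨a, ha⟩

lemma sum_emb_mul_log_replicate {q m : ℕ} (a : Fin q) :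
    ∑ x : Fin (m + 1) → Fin q with (List.replicate m a).Sublist (List.ofFn x),
      (emb (List.replicate m a) (List.ofFn x) : ℝ)
        * Real.log (emb (List.replicate m a) (List.ofFn x))
        = (m + 1) * Real.log (m + 1) := by
  set y := List.replicate m a with hy
  have h : y.length = m := by simp [hy]
  have hs := sum_emb_sub_one y h
  have hc : emb y (List.ofFn fun _ : Fin (m + 1) => a) = m + 1 := by
    rw [List.ofFn_const, emb_replicate]
  have hmem : (fun _ => a) ∈ Finset.univ.filter
      (fun x : Fin (m + 1) → Fin q => y.Sublist (List.ofFn x)) := by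
    rw [Finset.mem_filter, ← emb_pos_iff, hc]
    exact ⟨Finset.mem_univ _, m.succ_pos⟩
  rw [← Finset.add_sum_erase _ _ hmem, hc] at hs ⊢
  push_cast at hs ⊢
  have hz := (Finset.sum_eq_zero_iff_of_nonneg fun x hx => sub_nonneg.2
    (emb_bounds h (Finset.mem_filter.1 (Finset.mem_of_mem_erase hx)).2).1).1
    (by linarith : _ = (0 : ℝ))
  rw [Finset.sum_eq_zero, add_zero]
  intro x hx
  rw [sub_eq_zero.1 (hz x hx)]
  simp

/-- The input entropy of the single-deletion channel in terms of `∑ ω log ω`. -/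
lemma Hdel_one_eq {q m : ℕ} (hq : 0 < q) (y : Fin m → Fin q) :
    Hdel q (m + 1) 1 y = Real.logb 2 (((m + 1 : ℕ) : ℝ) * q)
      - (∑ x : Fin (m + 1) → Fin q with (List.ofFn y).Sublist (List.ofFn x),
        (emb (List.ofFn y) (List.ofFn x) : ℝ) * Real.log (emb (List.ofFn y) (List.ofFn x)))
          / ((m + 1) * q * Real.log 2) := by
  have hq' : (0 : ℝ) < q := by exact_mod_cast hq
  have hlog : Real.log 2 ≠ 0 := (Real.log_pos one_lt_two).ne'
  have hN : (0 : ℝ) < (m + 1) * q := by positivity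
  have hsum : ∑ x : Fin (m + 1) → Fin q with (List.ofFn y).Sublist (List.ofFn x),
      (emb (List.ofFn y) (List.ofFn x) : ℝ) = (m + 1) * q := by
    rw [Finset.sum_filter_of_ne fun x _ hx => (emb_pos_iff _ _).1
      (Nat.pos_of_ne_zero (by exact_mod_cast hx))]
    have := sum_emb (List.ofFn y) (List.length_ofFn)
    rw [mul_comm]
    exact_mod_cast this
  have hterm : ∀ x ∈ Finset.univ.filter
      (fun x : Fin (m + 1) → Fin q => (List.ofFn y).Sublist (List.ofFn x)),
      ((emb (List.ofFn y) (List.ofFn x) : ℝ) / (((m + 1).choose 1 : ℝ) * (q : ℝ) ^ 1)) *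
        Real.logb 2 ((emb (List.ofFn y) (List.ofFn x) : ℝ)
          / (((m + 1).choose 1 : ℝ) * (q : ℝ) ^ 1))
      = (emb (List.ofFn y) (List.ofFn x) : ℝ) * Real.log (emb (List.ofFn y) (List.ofFn x))
          / ((m + 1) * q * Real.log 2)
        - (emb (List.ofFn y) (List.ofFn x) : ℝ)
          * (Real.logb 2 ((m + 1) * q) / ((m + 1) * q)) := by
    intro x hx
    have h1 := (emb_bounds (List.length_ofFn (f := y)) (Finset.mem_filter.1 hx).2).1
    simp only [Nat.choose_one_right, pow_one, Nat.cast_add, Nat.cast_one]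
    rw [Real.logb, Real.log_div (by linarith) hN.ne', Real.logb]
    field_simp
  change -(∑ x : Fin (m + 1) → Fin q with (List.ofFn y).Sublist (List.ofFn x), _) = _
  rw [Finset.sum_congr rfl hterm, Finset.sum_sub_distrib, ← Finset.sum_div, ← Finset.sum_mul,
    hsum]
  push_cast
  field_simp
  ring

/-- For `n ≥ 2` and `q ≥ 2`, the minimum input entropy of the `1`-deletion channel over
all channel outputs in `Σ_q^{n-1}` equals `log₂(nq) - log₂(n)/q`, and it is attained
exactly by the constant channel outputs (those with a single run). -/
theorem stmt_9 (q n : ℕ) (hq : 2 ≤ q) (hn : 2 ≤ n) :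
    IsLeast ((fun y : Fin (n - 1) → Fin q => Hdel q n 1 y) '' Set.univ)
      (Real.logb 2 ((n : ℝ) * q) - Real.logb 2 (n : ℝ) / q)
    ∧ ∀ y : Fin (n - 1) → Fin q,
        (Hdel q n 1 y = Real.logb 2 ((n : ℝ) * q) - Real.logb 2 (n : ℝ) / q
          ↔ (runLengths (List.ofFn y)).length = 1) := by
  obtain ⟨m, rfl⟩ : ∃ m, n = m + 1 := ⟨n - 1, by omega⟩
  have hm : 0 < m := by omega
  have hq0 : 0 < q := by omega
  have hq' : (0 : ℝ) < q := by exact_mod_cast hq0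
  have hlog : 0 < Real.log 2 := Real.log_pos one_lt_two
  have hN : (0 : ℝ) < (m + 1) * q * Real.log 2 := by positivity
  have hmin : Real.logb 2 ((m + 1 : ℕ) : ℝ) / q
      = ((m + 1) * Real.log (m + 1)) / ((m + 1) * q * Real.log 2) := by
    push_cast
    rw [Real.logb]
    field_simp
  have hlen (y : Fin m → Fin q) : (List.ofFn y).length = m := List.length_ofFn
  have hne (y : Fin m → Fin q) : List.ofFn y ≠ [] := by
    rw [← List.length_pos_iff, hlen]
    exact hm
  have hle (y : Fin m → Fin q) :
      Real.logb 2 (((m + 1 : ℕ) : ℝ) * q) - Real.logb 2 ((m + 1 : ℕ) : ℝ) / q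
        ≤ Hdel q (m + 1) 1 y := by
    rw [Hdel_one_eq hq0, hmin]
    exact sub_le_sub_left
      (div_le_div_of_nonneg_right (sum_emb_mul_log_le hm _ (hlen y)) hN.le) _
  have hiff (y : Fin m → Fin q) :
      Hdel q (m + 1) 1 y
          = Real.logb 2 (((m + 1 : ℕ) : ℝ) * q) - Real.logb 2 ((m + 1 : ℕ) : ℝ) / q
        ↔ (runLengths (List.ofFn y)).length = 1 := by
    rw [length_runLengths_eq_one_iff (hne y), Hdel_one_eq hq0, hmin]
    constructor
    · intro h
      by_contra hy
      exact h.not_gt (sub_lt_sub_left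
        (div_lt_div_of_pos_right (sum_emb_mul_log_lt hm _ (hlen y) hy) hN) _)
    · rintro ⟨a, ha⟩
      rw [hlen] at ha
      rw [ha, sum_emb_mul_log_replicate]
  refine ⟨⟨⟨fun _ => ⟨0, hq0⟩, Set.mem_univ _, (hiff _).2 ?_⟩, ?_⟩, hiff⟩
  · rw [length_runLengths_eq_one_iff (hne _)]
    exact ⟨⟨0, hq0⟩, by simp [List.ofFn_const]⟩
  · rintro _ ⟨y, -, rfl⟩
    exact hle y

end
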